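/- Well-definedness and bounds for the value iteration (used in Lemma 3 and Proposition 3): define J_0 ≡ 0 and, for t ≥ 0, J_{t+1}(e) = min( θ + ∫_{ℝⁿ} J_t(y) p_Ξ(y) dy , eᵀAᵀΣA e + ∫_{ℝⁿ} J_t(y) p_Ξ(y − A e) dy ). Then for every t ≥ 0, J_t is a continuous function on ℝⁿ and 0 ≤ J_t(e) ≤ t·θ for all e ∈ ℝⁿ. -/

import Mathlib

open MeasureTheory Matrix

/-- Gaussian density with covariance `Ξ` on `ℝⁿ`. -/
noncomputable def gaussDensity (n : ℕ) (Ξ : Matrix (Fin n) (Fin n) ℝ) (y : Fin n → ℝ) : ℝ :=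
  (2 * Real.pi) ^ (-(n : ℝ) / 2) * Ξ.det ^ (-(1 : ℝ) / 2) *
    Real.exp (-(1 / 2) * (y ⬝ᵥ Ξ⁻¹.mulVec y))

/-- The value iteration sequence: `J_0 ≡ 0` and
`J_{t+1}(e) = min(θ + ∫ J_t(y) p_Ξ(y) dy, eᵀAᵀΣAe + ∫ J_t(y) p_Ξ(y - Ae) dy)`. -/
noncomputable def valueIter (n : ℕ) (A S Ξ : Matrix (Fin n) (Fin n) ℝ) (θ : ℝ) :
    ℕ → (Fin n → ℝ) → ℝ
  | 0 => fun _ => 0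
  | t + 1 => fun e =>
      min (θ + ∫ y : Fin n → ℝ, valueIter n A S Ξ θ t y * gaussDensity n Ξ y)
        (e ⬝ᵥ (Aᵀ * S * A).mulVec e +
          ∫ y : Fin n → ℝ, valueIter n A S Ξ θ t y * gaussDensity n Ξ (y - A.mulVec e))

lemma std_gauss (n : ℕ) : Integrable (fun x : Fin n → ℝ => Real.exp (-(1/2) * (x ⬝ᵥ x))) ∧
    ∫ x : Fin n → ℝ, Real.exp (-(1/2) * (x ⬝ᵥ x)) = (2 * Real.pi) ^ ((n : ℝ) / 2) := by
  have h : (fun x : Fin n → ℝ => Real.exp (-(1/2) * (x ⬝ᵥ x))) =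
      fun x => ∏ i, Real.exp (-(1/2) * (x i) ^ 2) := by
    funext x
    rw [← Real.exp_sum, dotProduct, Finset.mul_sum]
    simp only [pow_two]
  rw [h]
  constructor
  · exact Integrable.fintype_prod (f := fun _ : Fin n => fun x : ℝ => Real.exp (-(1/2) * x ^ 2))
      (fun _ => integrable_exp_neg_mul_sq (by norm_num))
  · rw [integral_fintype_prod_volume_eq_pow (fun x : ℝ => Real.exp (-(1/2) * x ^ 2)),
      integral_gaussian, Fintype.card_fin, Real.sqrt_eq_rpow, ← Real.rpow_natCast,
      ← Real.rpow_mul (by positivity)]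
    congr 1 <;> ring

open scoped MatrixOrder Matrix.Norms.L2Operator in
lemma gauss_facts (n : ℕ) (Ξ : Matrix (Fin n) (Fin n) ℝ) (hΞ : Ξ.PosDef) :
    Integrable (gaussDensity n Ξ) ∧ ∫ y, gaussDensity n Ξ y = 1 := by
  obtain ⟨C, hC⟩ := CStarAlgebra.nonneg_iff_eq_star_mul_self.mp hΞ.inv.posSemidef.nonneg
  rw [Matrix.star_eq_conjTranspose, Matrix.conjTranspose_eq_transpose_of_trivial] at hC
  have hd : 0 < Ξ.det := hΞ.det_pos
  have hdet : C.det ^ 2 = Ξ.det⁻¹ := by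
    have := congrArg Matrix.det hC
    rw [Matrix.det_mul, Matrix.det_transpose, Matrix.det_nonsing_inv, Ring.inverse_eq_inv'] at this
    rw [this, pow_two]
  have hC0 : C.det ≠ 0 := by
    intro h
    rw [h] at hdet
    have := inv_pos.mpr hd
    simp at hdet
    exact hd.ne hdet
  have habs : |C.det⁻¹| = Ξ.det ^ ((1:ℝ)/2) := by
    rw [← Real.sqrt_eq_rpow, ← Real.sqrt_sq_eq_abs, inv_pow, hdet, inv_inv]
  have hmap := Real.map_matrix_volume_pi_eq_smul_volume_pi hC0
  obtain ⟨hi, hv⟩ := std_gauss n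
  have hcont : Measurable (Matrix.toLin' C) := (LinearMap.continuous_of_finiteDimensional _).measurable
  have hi2 : Integrable (fun x : Fin n → ℝ => Real.exp (-(1/2) * (x ⬝ᵥ x)))
      (Measure.map (Matrix.toLin' C) volume) := by
    rw [hmap]
    exact hi.smul_measure ENNReal.ofReal_ne_top
  have hq : ∀ y, y ⬝ᵥ Ξ⁻¹.mulVec y = (Matrix.toLin' C y) ⬝ᵥ (Matrix.toLin' C y) := by
    intro y
    rw [hC, Matrix.toLin'_apply, ← Matrix.mulVec_mulVec, Matrix.dotProduct_mulVec,
      Matrix.vecMul_transpose]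
  have hi3 := hi2.comp_measurable hcont
  have hv3 : ∫ y, Real.exp (-(1/2) * (y ⬝ᵥ Ξ⁻¹.mulVec y)) =
      Ξ.det ^ ((1:ℝ)/2) * (2 * Real.pi) ^ ((n : ℝ) / 2) := by
    simp only [hq]
    rw [← integral_map (f := fun x : Fin n → ℝ => Real.exp (-(1/2) * (x ⬝ᵥ x)))
      hcont.aemeasurable hi2.aestronglyMeasurable, hmap, integral_smul_measure, hv,
      ENNReal.toReal_ofReal (abs_nonneg _), habs, smul_eq_mul]
  constructor
  · unfold gaussDensity
    apply Integrable.const_mul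
    simp only [hq]
    exact hi3
  · unfold gaussDensity
    rw [integral_const_mul, hv3, neg_div, neg_div, Real.rpow_neg (by positivity),
      Real.rpow_neg hd.le]
    have h1 : (2 * Real.pi) ^ ((n : ℝ) / 2) ≠ 0 := by positivity
    have h2 : Ξ.det ^ ((1:ℝ)/2) ≠ 0 := by positivity
    field_simp

/-- Well-definedness and bounds for the value iteration: every `J_t` is continuous and
`0 ≤ J_t(e) ≤ t·θ`. -/
theorem valueIter_continuous_and_bounded
    (n : ℕ) (hn : 1 ≤ n) (A S Ξ : Matrix (Fin n) (Fin n) ℝ)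
    (hS : S.PosSemidef) (hΞ : Ξ.PosDef) (θ : ℝ) (hθ : 0 < θ) :
    ∀ t : ℕ, Continuous (valueIter n A S Ξ θ t) ∧
      ∀ e : Fin n → ℝ, 0 ≤ valueIter n A S Ξ θ t e ∧ valueIter n A S Ξ θ t e ≤ t * θ := by
  obtain ⟨hgi, hgv⟩ := gauss_facts n Ξ hΞ
  have hd : 0 < Ξ.det := hΞ.det_pos
  have hg0 : ∀ y, 0 ≤ gaussDensity n Ξ y := by
    intro y
    unfold gaussDensity
    positivity
  intro t
  induction t with
  | zero =>
    refine ⟨continuous_const, fun e => ?_⟩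
    simp [valueIter]
  | succ t ih =>
    obtain ⟨hc, hb⟩ := ih
    have hsub : ∀ e : Fin n → ℝ,
        ∫ y : Fin n → ℝ, valueIter n A S Ξ θ t y * gaussDensity n Ξ (y - A.mulVec e) =
        ∫ y : Fin n → ℝ, valueIter n A S Ξ θ t (y + A.mulVec e) * gaussDensity n Ξ y := by
      intro e
      rw [← integral_add_right_eq_self _ (A.mulVec e)]
      simp only [add_sub_cancel_right]
    have hbound : ∀ y z, ‖valueIter n A S Ξ θ t z * gaussDensity n Ξ y‖ ≤
        t * θ * gaussDensity n Ξ y := by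
      intro y z
      rw [Real.norm_of_nonneg (mul_nonneg (hb z).1 (hg0 y))]
      exact mul_le_mul_of_nonneg_right (hb z).2 (hg0 y)
    have hcI : Continuous fun e : Fin n → ℝ =>
        ∫ y : Fin n → ℝ, valueIter n A S Ξ θ t (y + A.mulVec e) * gaussDensity n Ξ y := by
      refine continuous_of_dominated (bound := fun y => t * θ * gaussDensity n Ξ y) ?_ ?_ ?_ ?_
      · intro e
        exact (hc.comp (by fun_prop)).aestronglyMeasurable.mul hgi.aestronglyMeasurable
      · exact fun e => Filter.Eventually.of_forall fun y => hbound y _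
      · exact hgi.const_mul _
      · exact Filter.Eventually.of_forall fun y =>
          (hc.comp (continuous_const.add (continuous_const.matrix_mulVec continuous_id))).mul
            continuous_const
    constructor
    · simp only [valueIter, hsub]
      refine continuous_const.min (Continuous.add ?_ hcI)
      exact continuous_id.dotProduct (continuous_const.matrix_mulVec continuous_id)
    · intro e
      have hI : ∫ y : Fin n → ℝ, valueIter n A S Ξ θ t y * gaussDensity n Ξ y ≤ t * θ := by
        calc _ ≤ ∫ y, t * θ * gaussDensity n Ξ y :=
              integral_mono_of_nonneg
                (Filter.Eventually.of_forall fun y => mul_nonneg (hb y).1 (hg0 y))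
                (hgi.const_mul _)
                (Filter.Eventually.of_forall fun y => 
                  mul_le_mul_of_nonneg_right (hb y).2 (hg0 y))
          _ = t * θ := by rw [integral_const_mul, hgv, mul_one]
      have hq : 0 ≤ e ⬝ᵥ (Aᵀ * S * A).mulVec e := by
        have := (hS.conjTranspose_mul_mul_same A).dotProduct_mulVec_nonneg e
        simpa [Matrix.conjTranspose_eq_transpose_of_trivial] using this
      simp only [valueIter]
      constructor
      · refine le_min (add_nonneg hθ.le ?_) (add_nonneg hq ?_)
        · exact integral_nonneg fun y => mul_nonneg (hb y).1 (hg0 y)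
        · exact integral_nonneg fun y => mul_nonneg (hb y).1 (hg0 _)
      · refine (min_le_left _ _).trans ?_
        push_cast
        linarith
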